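/- arXiv:2203.00425 — 2 statements merged into one kernel-verified Lean document; each statement's English description precedes it below -/
import Mathlib

section
/- Let k be a natural number, r ≥ 0, and let g₁, g₂ ∈ L¹(ℝ², ℂ) with ‖g₁‖_{L¹} ≤ r and ‖g₂‖_{L¹} ≤ r. Define f_j(x,y) = ∫_{ℝ²} e^{2πi(xξ+yη)} g_j(ξ,η) dξ dη for j = 1, 2. Then there exists h ∈ L¹(ℝ², ℂ) with ‖h‖_{L¹} ≤ (2k+1) r^{2k} ‖g₁ − g₂‖_{L¹} such that for every (x,y) ∈ ℝ², |f₁(x,y)|^{2k} f₁(x,y) − |f₂(x,y)|^{2k} f₂(x,y) = ∫_{ℝ²} e^{2πi(xξ+yη)} h(ξ,η) dξ dη. (This is the Lipschitz estimate ‖𝓕(|u|^{2k}u − |v|^{2k}v)‖_{L¹} ≤ (2k+1) r^{2k} ‖𝓕u − 𝓕v‖_{L¹} for the nonlinearity in the Wiener algebra.) -/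
open MeasureTheory Complex

open scoped Convolution

/-- The character `(ξ, η) ↦ exp (2πi(xξ + yη))` of the plane. -/
noncomputable def planeCharacter (x y : ℝ) (p : ℝ × ℝ) : ℂ :=
  Complex.exp (2 * Real.pi * Complex.I * (x * p.1 + y * p.2))

theorem planeCharacter_add (x y : ℝ) (p q : ℝ × ℝ) :
    planeCharacter x y (p + q) = planeCharacter x y p * planeCharacter x y q := by
  simp only [planeCharacter, ← Complex.exp_add, Prod.fst_add, Prod.snd_add, Complex.ofReal_add]
  ring_nf

theorem conj_planeCharacter (x y : ℝ) (p : ℝ × ℝ) :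
    starRingEnd ℂ (planeCharacter x y p) = planeCharacter x y (-p) := by
  simp only [planeCharacter, ← Complex.exp_conj, map_mul, map_add, map_ofNat, Complex.conj_ofReal,
    Complex.conj_I, Prod.fst_neg, Prod.snd_neg, Complex.ofReal_neg]
  ring_nf

theorem norm_planeCharacter (x y : ℝ) (p : ℝ × ℝ) : ‖planeCharacter x y p‖ = 1 := by
  rw [planeCharacter, show 2 * (Real.pi : ℂ) * I * (x * p.1 + y * p.2) =
    ((2 * Real.pi * (x * p.1 + y * p.2) : ℝ) : ℂ) * I by push_cast; ring]
  exact Complex.norm_exp_ofReal_mul_I _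

theorem continuous_planeCharacter (x y : ℝ) : Continuous (planeCharacter x y) := by
  unfold planeCharacter
  fun_prop

theorem integrable_planeCharacter_mul (x y : ℝ) {g : ℝ × ℝ → ℂ} (hg : Integrable g) :
    Integrable fun p => planeCharacter x y p * g p :=
  hg.bdd_mul (c := 1) (continuous_planeCharacter x y).aestronglyMeasurable
    (.of_forall fun p => (norm_planeCharacter x y p).le)

/-- `F` is the inverse Fourier integral of a function of `L¹`-norm at most `C`. -/
def WienerBound (F : ℝ → ℝ → ℂ) (C : ℝ) : Prop :=
  ∃ h : ℝ × ℝ → ℂ, Integrable h ∧ (∫ p, ‖h p‖) ≤ C ∧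
    ∀ x y, F x y = ∫ p, planeCharacter x y p * h p

namespace WienerBound

variable {F G : ℝ → ℝ → ℂ} {A B : ℝ}

theorem nonneg (hF : WienerBound F A) : 0 ≤ A := by
  obtain ⟨h, -, hA, -⟩ := hF
  exact (integral_nonneg fun p => norm_nonneg _).trans hA

theorem add (hF : WienerBound F A) (hG : WienerBound G B) :
    WienerBound (fun x y => F x y + G x y) (A + B) := by
  obtain ⟨f, hf, hA, hF⟩ := hF
  obtain ⟨g, hg, hB, hG⟩ := hG
  refine ⟨fun p => f p + g p, hf.add hg, ?_, fun x y => ?_⟩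
  · calc (∫ p, ‖f p + g p‖) ≤ ∫ p, (‖f p‖ + ‖g p‖) :=
          integral_mono (hf.add hg).norm (hf.norm.add hg.norm) fun p => norm_add_le _ _
      _ = (∫ p, ‖f p‖) + ∫ p, ‖g p‖ := integral_add hf.norm hg.norm
      _ ≤ A + B := add_le_add hA hB
  · simp only [hF, hG, mul_add]
    exact (integral_add (integrable_planeCharacter_mul x y hf)
      (integrable_planeCharacter_mul x y hg)).symm

theorem conj (hF : WienerBound F A) : WienerBound (fun x y => starRingEnd ℂ (F x y)) A := by
  obtain ⟨f, hf, hA, hF⟩ := hF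
  refine ⟨fun p => starRingEnd ℂ (f (-p)), ?_, ?_, fun x y => ?_⟩
  · exact (integrable_norm_iff
      (Complex.continuous_conj.comp_aestronglyMeasurable hf.comp_neg.aestronglyMeasurable)).1
      (by simpa using hf.comp_neg.norm)
  · simpa [integral_neg_eq_self (fun p : ℝ × ℝ => ‖f p‖)] using hA
  · simp only [hF, ← integral_conj]
    rw [← integral_neg_eq_self]
    simp [conj_planeCharacter]

theorem mul (hF : WienerBound F A) (hG : WienerBound G B) :
    WienerBound (fun x y => F x y * G x y) (A * B) := by
  have hA0 := hF.nonneg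
  obtain ⟨f, hf, hA, hF⟩ := hF
  obtain ⟨g, hg, hB, hG⟩ := hG
  refine ⟨f ⋆[ContinuousLinearMap.mul ℝ ℂ] g, hf.integrable_convolution _ hg, ?_, fun x y => ?_⟩
  · calc (∫ p, ‖(f ⋆[ContinuousLinearMap.mul ℝ ℂ] g) p‖)
        ≤ ∫ p, ((fun q => ‖f q‖) ⋆[ContinuousLinearMap.mul ℝ ℝ] fun q => ‖g q‖) p := by
          refine integral_mono (hf.integrable_convolution _ hg).norm
            (hf.norm.integrable_convolution _ hg.norm) fun p => ?_
          simpa [convolution_def] using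
            norm_integral_le_integral_norm (fun t => f t * g (p - t))
      _ = (∫ p, ‖f p‖) * ∫ p, ‖g p‖ := integral_convolution _ hf.norm hg.norm
      _ ≤ A * B := mul_le_mul hA hB (integral_nonneg fun p => norm_nonneg _) hA0
  · simp only [hF, hG]
    refine (integral_convolution (ContinuousLinearMap.mul ℝ ℂ)
      (integrable_planeCharacter_mul x y hf)
      (integrable_planeCharacter_mul x y hg)).symm.trans (integral_congr_ae (.of_forall fun p => ?_))
    simp only [convolution_def, ContinuousLinearMap.mul_apply', ← integral_const_mul]
    refine integral_congr_ae (.of_forall fun t => ?_)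
    have := planeCharacter_add x y t (p - t)
    rw [add_sub_cancel] at this
    simp only [this]
    ring

theorem powerNonlinearity (hF : WienerBound F A) (k : ℕ) :
    WienerBound (fun x y => F x y ^ (k + 1) * starRingEnd ℂ (F x y) ^ k) (A ^ (2 * k + 1)) := by
  induction k with
  | zero => simpa using hF
  | succ k ih =>
    convert ih.mul (hF.mul hF.conj) using 1
    · funext x y
      ring
    · ring

theorem powerNonlinearity_sub (hF : WienerBound F A) (hG : WienerBound G A)
    (hFG : WienerBound (fun x y => F x y - G x y) B) (k : ℕ) :
    WienerBound (fun x y => F x y ^ (k + 1) * starRingEnd ℂ (F x y) ^ k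
      - G x y ^ (k + 1) * starRingEnd ℂ (G x y) ^ k) ((2 * k + 1) * A ^ (2 * k) * B) := by
  induction k with
  | zero => simpa using hFG
  | succ k ih =>
    have hsq := (hFG.mul hF.conj).add (hG.mul hFG.conj)
    convert (ih.mul (hF.mul hF.conj)).add ((hG.powerNonlinearity k).mul hsq) using 1
    · funext x y
      simp only [map_sub]
      ring
    · push_cast
      ring

end WienerBound

/-- Lipschitz estimate for the nonlinearity `u ↦ |u|^{2k}u = u^{k+1} ū^k` in the Wiener
algebra: if `f₁ = 𝓕⁻¹ g₁`, `f₂ = 𝓕⁻¹ g₂` with `‖g₁‖_{L¹}, ‖g₂‖_{L¹} ≤ r`, then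
`|f₁|^{2k}f₁ − |f₂|^{2k}f₂` is the inverse Fourier integral of some `h ∈ L¹` with
`‖h‖_{L¹} ≤ (2k+1) r^{2k} ‖g₁ − g₂‖_{L¹}`. -/
theorem fourier_L1_power_nonlinearity_lipschitz (k : ℕ) (r : ℝ) (hr : 0 ≤ r)
    (g₁ g₂ : ℝ × ℝ → ℂ)
    (hg₁ : Integrable g₁ (volume : Measure (ℝ × ℝ)))
    (hg₂ : Integrable g₂ (volume : Measure (ℝ × ℝ)))
    (hg₁r : (∫ p : ℝ × ℝ, ‖g₁ p‖) ≤ r) (hg₂r : (∫ p : ℝ × ℝ, ‖g₂ p‖) ≤ r)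
    (f₁ f₂ : ℝ × ℝ → ℂ)
    (hf₁ : ∀ x y : ℝ, f₁ (x, y) =
      ∫ p : ℝ × ℝ, Complex.exp (2 * Real.pi * Complex.I * (x * p.1 + y * p.2)) * g₁ p)
    (hf₂ : ∀ x y : ℝ, f₂ (x, y) =
      ∫ p : ℝ × ℝ, Complex.exp (2 * Real.pi * Complex.I * (x * p.1 + y * p.2)) * g₂ p) :
    ∃ h : ℝ × ℝ → ℂ, Integrable h (volume : Measure (ℝ × ℝ)) ∧
      (∫ p : ℝ × ℝ, ‖h p‖) ≤ (2 * k + 1) * r ^ (2 * k) * ∫ p : ℝ × ℝ, ‖g₁ p - g₂ p‖ ∧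
      ∀ x y : ℝ,
        (f₁ (x, y)) ^ (k + 1) * (starRingEnd ℂ (f₁ (x, y))) ^ k
          - (f₂ (x, y)) ^ (k + 1) * (starRingEnd ℂ (f₂ (x, y))) ^ k =
        ∫ p : ℝ × ℝ, Complex.exp (2 * Real.pi * Complex.I * (x * p.1 + y * p.2)) * h p := by
  have hW₁ : WienerBound (fun x y => f₁ (x, y)) r := ⟨g₁, hg₁, hg₁r, hf₁⟩
  have hW₂ : WienerBound (fun x y => f₂ (x, y)) r := ⟨g₂, hg₂, hg₂r, hf₂⟩
  refine hW₁.powerNonlinearity_sub hW₂ ⟨fun p => g₁ p - g₂ p, hg₁.sub hg₂, le_rfl, fun x y => ?_⟩ k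
  simp only [hf₁, hf₂, mul_sub]
  exact (integral_sub (integrable_planeCharacter_mul x y hg₁)
    (integrable_planeCharacter_mul x y hg₂)).symm
end

section
/- Let k ≥ 1 be a natural number, r ≥ 0, and let u, v : ℝ² → ℂ be bounded measurable functions with ‖u‖_{L^∞} ≤ r, ‖v‖_{L^∞} ≤ r, and finite Gagliardo half-derivative seminorms in y satisfying [u] ≤ r and [v] ≤ r. Then [|u|^{2k}u − |v|^{2k}v] ≤ 2(2k+1)² r^{2k} ( [u − v] + ‖u − v‖_{L^∞} ). -/
open MeasureTheory ENNReal

/-- The square of the Gagliardo half-derivative seminorm in the second variable: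
`[u]² = ∫_ℝ ∫_ℝ ∫_ℝ |u(x,y) − u(x,y′)|² (y − y′)^{−2} dy dy′ dx`. -/
noncomputable def gagliardoYSq (u : ℝ × ℝ → ℂ) : ℝ≥0∞ :=
  ∫⁻ q : ℝ × ℝ × ℝ,
    (‖u (q.1, q.2.1) - u (q.1, q.2.2)‖₊ : ℝ≥0∞) ^ 2
      / ENNReal.ofReal ((q.2.1 - q.2.2) ^ 2)

/-- The difference quotient `|u(x,y) − u(x,y′)| / |y − y′|` as a function on `ℝ × ℝ × ℝ`. -/
noncomputable def gagliardoYQuotient (u : ℝ × ℝ → ℂ) (q : ℝ × ℝ × ℝ) : ℝ≥0∞ :=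
  ‖u (q.1, q.2.1) - u (q.1, q.2.2)‖ₑ * (ENNReal.ofReal |q.2.1 - q.2.2|)⁻¹

theorem measurable_gagliardoYQuotient {u : ℝ × ℝ → ℂ} (hu : Measurable u) :
    Measurable (gagliardoYQuotient u) := by
  unfold gagliardoYQuotient
  fun_prop

theorem gagliardoYSq_rpow_half (u : ℝ × ℝ → ℂ) :
    (gagliardoYSq u) ^ (1 / 2 : ℝ) = eLpNorm (gagliardoYQuotient u) 2 volume := by
  rw [eLpNorm_eq_lintegral_rpow_enorm_toReal two_ne_zero ENNReal.ofNat_ne_top]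
  simp only [ENNReal.toReal_ofNat, enorm_eq_self, gagliardoYSq]
  congr 1
  refine lintegral_congr fun q => ?_
  rw [gagliardoYQuotient, ENNReal.rpow_ofNat, mul_pow, div_eq_mul_inv, ← sq_abs (q.2.1 - q.2.2),
    ENNReal.ofReal_pow (abs_nonneg _), ENNReal.inv_pow]
  rfl

theorem eLpNorm_two_const_mul {α : Type*} [MeasurableSpace α] {μ : Measure α} (c : ℝ≥0∞)
    {f : α → ℝ≥0∞} (hf : Measurable f) :
    eLpNorm (fun x => c * f x) 2 μ = c * eLpNorm f 2 μ := by
  simp only [eLpNorm_eq_lintegral_rpow_enorm_toReal two_ne_zero ENNReal.ofNat_ne_top,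
    ENNReal.toReal_ofNat, enorm_eq_self, ENNReal.rpow_ofNat, mul_pow]
  rw [lintegral_const_mul _ (hf.pow_const 2), ENNReal.mul_rpow_of_nonneg _ _ (by norm_num),
    ← ENNReal.rpow_ofNat c, ← ENNReal.rpow_mul]
  norm_num

theorem ae_norm_le_of_eLpNorm_top_le {α F : Type*} [MeasurableSpace α] [NormedAddCommGroup F]
    {μ : Measure α} {f : α → F} {r : ℝ} (hr : 0 ≤ r) (h : eLpNorm f ⊤ μ ≤ ENNReal.ofReal r) :
    ∀ᵐ x ∂μ, ‖f x‖ ≤ r := by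
  rw [eLpNorm_exponent_top] at h
  filter_upwards [enorm_ae_le_eLpNormEssSup f μ] with x hx
  rw [← ofReal_norm] at hx
  exact (ENNReal.ofReal_le_ofReal_iff hr).1 (hx.trans h)

theorem ae_left_slice {p : ℝ × ℝ → Prop} (h : ∀ᵐ z, p z) :
    ∀ᵐ q : ℝ × ℝ × ℝ, p (q.1, q.2.1) :=
  (MeasureTheory.QuasiMeasurePreserving.prodMap (Measure.QuasiMeasurePreserving.id volume)
    Measure.quasiMeasurePreserving_fst).ae h

theorem ae_right_slice {p : ℝ × ℝ → Prop} (h : ∀ᵐ z, p z) :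
    ∀ᵐ q : ℝ × ℝ × ℝ, p (q.1, q.2.2) :=
  (MeasureTheory.QuasiMeasurePreserving.prodMap (Measure.QuasiMeasurePreserving.id volume)
    Measure.quasiMeasurePreserving_snd).ae h

/-- Bounds on the values `p`, `q`, `p'`, `q'` at `a`, `b`, `a'`, `b'` of a monomial of degree
`j + 1` in a variable and its conjugate, where the variables are bounded by `r`, the differences
`a - b` and `a' - b'` by `W`, the differences `a - a'` and `b - b'` by `S` and `T`, and the second
difference `(a - b) - (a' - b')` by `D`. -/
structure SecondDifferenceBound (j : ℕ) (r W S T D : ℝ) (p q p' q' : ℂ) : Prop where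
  norm_fst : ‖p‖ ≤ r ^ (j + 1)
  norm_snd : ‖q‖ ≤ r ^ (j + 1)
  norm_fst' : ‖p'‖ ≤ r ^ (j + 1)
  norm_snd' : ‖q'‖ ≤ r ^ (j + 1)
  sub : ‖p - q‖ ≤ (j + 1) * r ^ j * W
  sub' : ‖p' - q'‖ ≤ (j + 1) * r ^ j * W
  sub_snd : ‖q - q'‖ ≤ (j + 1) * r ^ j * T
  second : ‖(p - q) - (p' - q')‖ ≤
    (j + 1) * r ^ j * D + (j + 1) * j / 2 * r ^ (j - 1) * W * (S + T)

theorem norm_mul_sub_mul_le {j : ℕ} {r W : ℝ} {p q a b : ℂ} (hr : 0 ≤ r)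
    (hq : ‖q‖ ≤ r ^ (j + 1)) (ha : ‖a‖ ≤ r)
    (hpq : ‖p - q‖ ≤ (j + 1) * r ^ j * W) (hab : ‖a - b‖ ≤ W) :
    ‖p * a - q * b‖ ≤ ((j + 1 : ℕ) + 1) * r ^ (j + 1) * W := by
  calc ‖p * a - q * b‖ = ‖(p - q) * a + q * (a - b)‖ := by ring_nf
    _ ≤ ‖p - q‖ * ‖a‖ + ‖q‖ * ‖a - b‖ := by
      simpa only [norm_mul] using norm_add_le ((p - q) * a) (q * (a - b))
    _ ≤ ((j + 1) * r ^ j * W) * r + r ^ (j + 1) * W :=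
      add_le_add (mul_le_mul hpq ha (norm_nonneg _) ((norm_nonneg _).trans hpq))
        (mul_le_mul hq hab (norm_nonneg _) (by positivity))
    _ = _ := by push_cast; ring

theorem SecondDifferenceBound.mul {j : ℕ} {r W S T D : ℝ} {p q p' q' a b a' b' : ℂ}
    (hr : 0 ≤ r) (h : SecondDifferenceBound j r W S T D p q p' q')
    (g : SecondDifferenceBound 0 r W S T D a b a' b') (haa : ‖a - a'‖ ≤ S) :
    SecondDifferenceBound (j + 1) r W S T D (p * a) (q * b) (p' * a') (q' * b') := by
  obtain ⟨h1, h2, h3, h4, h5, h6, h7, h8⟩ := h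
  obtain ⟨g1, g2, g3, g4, g5, g6, g7, g8⟩ := g
  simp only [zero_add, pow_one, pow_zero, CharP.cast_eq_zero, mul_one, one_mul, mul_zero,
    zero_div, zero_mul, add_zero] at g1 g2 g3 g4 g5 g6 g7 g8
  have hnorm : ∀ {x y : ℂ}, ‖x‖ ≤ r ^ (j + 1) → ‖y‖ ≤ r → ‖x * y‖ ≤ r ^ (j + 1 + 1) :=
    fun {x y} hx hy => by
      rw [norm_mul, pow_succ]
      exact mul_le_mul hx hy (norm_nonneg _) (by positivity)
  refine ⟨hnorm h1 g1, hnorm h2 g2, hnorm h3 g3, hnorm h4 g4, norm_mul_sub_mul_le hr h2 g1 h5 g5,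
    norm_mul_sub_mul_le hr h4 g3 h6 g6, norm_mul_sub_mul_le hr h4 g2 h7 g7, ?_⟩
  have hpow : (j : ℝ) * r ^ (j - 1) * r = j * r ^ j := by
    cases j with
    | zero => simp
    | succ n => rw [Nat.add_sub_cancel, mul_assoc, ← pow_succ]
  calc ‖(p * a - q * b) - (p' * a' - q' * b')‖
      = ‖((p - q) - (p' - q')) * a + (p' - q') * (a - a') + (q - q') * (a - b)
          + q' * ((a - b) - (a' - b'))‖ := by ring_nf
    _ ≤ ‖(p - q) - (p' - q')‖ * ‖a‖ + ‖p' - q'‖ * ‖a - a'‖ + ‖q - q'‖ * ‖a - b‖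
          + ‖q'‖ * ‖(a - b) - (a' - b')‖ := by
      simp only [← norm_mul]
      exact norm_add₄_le
    _ ≤ ((j + 1) * r ^ j * D + (j + 1) * j / 2 * r ^ (j - 1) * W * (S + T)) * r
          + ((j + 1) * r ^ j * W) * S + ((j + 1) * r ^ j * T) * W + r ^ (j + 1) * D :=
      add_le_add (add_le_add (add_le_add
        (mul_le_mul h8 g1 (norm_nonneg _) ((norm_nonneg _).trans h8))
        (mul_le_mul h6 haa (norm_nonneg _) ((norm_nonneg _).trans h6)))
        (mul_le_mul h7 g5 (norm_nonneg _) ((norm_nonneg _).trans h7)))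
        (mul_le_mul h4 g8 (norm_nonneg _) (by positivity))
    _ = _ := by
      rw [Nat.add_sub_cancel]
      push_cast
      linear_combination (j + 1) / 2 * W * (S + T) * hpow

theorem norm_power_nonlinearity_second_difference_le (k : ℕ) {r W : ℝ} {a b a' b' : ℂ}
    (hr : 0 ≤ r) (ha : ‖a‖ ≤ r) (hb : ‖b‖ ≤ r) (ha' : ‖a'‖ ≤ r)
    (hb' : ‖b'‖ ≤ r) (hab : ‖a - b‖ ≤ W) (hab' : ‖a' - b'‖ ≤ W) :
    ‖(a ^ (k + 1) * (starRingEnd ℂ a) ^ k - b ^ (k + 1) * (starRingEnd ℂ b) ^ k)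
        - (a' ^ (k + 1) * (starRingEnd ℂ a') ^ k - b' ^ (k + 1) * (starRingEnd ℂ b') ^ k)‖
      ≤ (2 * k + 1 : ℕ) * r ^ (2 * k) * ‖(a - b) - (a' - b')‖
        + (2 * k + 1 : ℕ) * k * r ^ (2 * k - 1) * W * (‖a - a'‖ + ‖b - b'‖) := by
  have base : SecondDifferenceBound 0 r W ‖a - a'‖ ‖b - b'‖ ‖(a - b) - (a' - b')‖ a b a' b' := by
    constructor <;> simp [*]
  have conj : SecondDifferenceBound 0 r W ‖a - a'‖ ‖b - b'‖ ‖(a - b) - (a' - b')‖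
      (starRingEnd ℂ a) (starRingEnd ℂ b) (starRingEnd ℂ a') (starRingEnd ℂ b') := by
    constructor <;> simp only [← map_sub, RCLike.norm_conj] <;> simp [*]
  have main : SecondDifferenceBound (2 * k) r W ‖a - a'‖ ‖b - b'‖ ‖(a - b) - (a' - b')‖
      (a ^ (k + 1) * (starRingEnd ℂ a) ^ k) (b ^ (k + 1) * (starRingEnd ℂ b) ^ k)
      (a' ^ (k + 1) * (starRingEnd ℂ a') ^ k) (b' ^ (k + 1) * (starRingEnd ℂ b') ^ k) := by
    induction k with
    | zero => simpa using base
    | succ k ih =>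
      have step := (ih.mul hr base le_rfl).mul hr conj (by rw [← map_sub, RCLike.norm_conj])
      have e : ∀ z : ℂ, z ^ (k + 1 + 1) * (starRingEnd ℂ z) ^ (k + 1)
          = z ^ (k + 1) * (starRingEnd ℂ z) ^ k * z * starRingEnd ℂ z := fun z => by ring
      simp only [e, mul_add_one]
      exact step
  refine main.second.trans_eq ?_
  push_cast
  ring

/-- Lipschitz estimate for the nonlinearity `|u|^{2k}u = u^{k+1} ū^k` in the Gagliardo
half-derivative seminorm in `y`: if `‖u‖_∞, ‖v‖_∞ ≤ r` and `[u], [v] ≤ r`, then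
`[|u|^{2k}u − |v|^{2k}v] ≤ 2 (2k+1)² r^{2k} ([u − v] + ‖u − v‖_∞)`. -/
theorem gagliardo_power_nonlinearity_lipschitz (k : ℕ) (hk : 1 ≤ k) (r : ℝ) (hr : 0 ≤ r)
    (u v : ℝ × ℝ → ℂ) (hmu : Measurable u) (hmv : Measurable v)
    (hub : eLpNorm u ⊤ (volume : Measure (ℝ × ℝ)) ≤ ENNReal.ofReal r)
    (hvb : eLpNorm v ⊤ (volume : Measure (ℝ × ℝ)) ≤ ENNReal.ofReal r)
    (hgu : (gagliardoYSq u) ^ (1 / 2 : ℝ) ≤ ENNReal.ofReal r)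
    (hgv : (gagliardoYSq v) ^ (1 / 2 : ℝ) ≤ ENNReal.ofReal r) :
    (gagliardoYSq (fun p : ℝ × ℝ =>
        (u p) ^ (k + 1) * (starRingEnd ℂ (u p)) ^ k
          - (v p) ^ (k + 1) * (starRingEnd ℂ (v p)) ^ k)) ^ (1 / 2 : ℝ)
      ≤ 2 * ((2 * k + 1 : ℕ) : ℝ≥0∞) ^ 2 * (ENNReal.ofReal r) ^ (2 * k)
          * ((gagliardoYSq (u - v)) ^ (1 / 2 : ℝ)
              + eLpNorm (u - v) ⊤ (volume : Measure (ℝ × ℝ))) := by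
  have hm : Measurable (u - v) := hmu.sub hmv
  set E : ℝ≥0∞ := eLpNorm (u - v) ⊤ (volume : Measure (ℝ × ℝ))
  have hEtop : E ≠ ⊤ := by
    refine ne_top_of_le_ne_top ?_ (eLpNorm_sub_le hmu.aestronglyMeasurable
      hmv.aestronglyMeasurable le_top)
    exact ENNReal.add_ne_top.2 ⟨ne_top_of_le_ne_top ofReal_ne_top hub,
      ne_top_of_le_ne_top ofReal_ne_top hvb⟩
  have hEr : E = ENNReal.ofReal E.toReal := (ENNReal.ofReal_toReal hEtop).symm
  have hu := ae_norm_le_of_eLpNorm_top_le hr hub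
  have hv := ae_norm_le_of_eLpNorm_top_le hr hvb
  have hw := ae_norm_le_of_eLpNorm_top_le E.toReal_nonneg hEr.le
  set A : ℝ := (2 * k + 1 : ℕ) * r ^ (2 * k) with hA
  set B : ℝ := (2 * k + 1 : ℕ) * k * r ^ (2 * k - 1) * E.toReal with hB
  have hA0 : 0 ≤ A := by positivity
  have hB0 : 0 ≤ B := by positivity
  set G : ℝ × ℝ → ℂ := fun p => (u p) ^ (k + 1) * (starRingEnd ℂ (u p)) ^ k
          - (v p) ^ (k + 1) * (starRingEnd ℂ (v p)) ^ k with hG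
  have key : ∀ᵐ q : ℝ × ℝ × ℝ, gagliardoYQuotient G q ≤ ENNReal.ofReal A *
      gagliardoYQuotient (u - v) q + ENNReal.ofReal B *
        (gagliardoYQuotient u q + gagliardoYQuotient v q) := by
    filter_upwards [ae_left_slice hu, ae_right_slice hu, ae_left_slice hv, ae_right_slice hv,
      ae_left_slice hw, ae_right_slice hw] with q h1 h2 h3 h4 h5 h6
    have hp := norm_power_nonlinearity_second_difference_le k hr h1 h3 h2 h4 h5 h6
    have hp' : ‖G (q.1, q.2.1) - G (q.1, q.2.2)‖ₑ ≤ ENNReal.ofReal A *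
        ‖(u - v) (q.1, q.2.1) - (u - v) (q.1, q.2.2)‖ₑ + ENNReal.ofReal B *
        (‖u (q.1, q.2.1) - u (q.1, q.2.2)‖ₑ + ‖v (q.1, q.2.1) - v (q.1, q.2.2)‖ₑ) := by
      simp only [← ofReal_norm]
      rw [← ENNReal.ofReal_add (norm_nonneg _) (norm_nonneg _), ← ENNReal.ofReal_mul hA0,
        ← ENNReal.ofReal_mul hB0, ← ENNReal.ofReal_add (by positivity) (by positivity)]
      exact ENNReal.ofReal_le_ofReal hp
    calc gagliardoYQuotient G q ≤ (ENNReal.ofReal A *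
        ‖(u - v) (q.1, q.2.1) - (u - v) (q.1, q.2.2)‖ₑ + ENNReal.ofReal B *
        (‖u (q.1, q.2.1) - u (q.1, q.2.2)‖ₑ + ‖v (q.1, q.2.1) - v (q.1, q.2.2)‖ₑ)) *
          (ENNReal.ofReal |q.2.1 - q.2.2|)⁻¹ := by
          unfold gagliardoYQuotient
          gcongr
      _ = _ := by
          unfold gagliardoYQuotient
          ring
  rw [gagliardoYSq_rpow_half] at hgu hgv ⊢
  rw [gagliardoYSq_rpow_half]
  have mu := measurable_gagliardoYQuotient hmu
  have mv := measurable_gagliardoYQuotient hmv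
  have mw := measurable_gagliardoYQuotient hm
  have hrB : ENNReal.ofReal B * (ENNReal.ofReal r + ENNReal.ofReal r)
      = ENNReal.ofReal ((2 * k + 1 : ℕ) * (2 * k) * r ^ (2 * k)) * E := by
    conv_rhs => rw [hEr]
    rw [← ENNReal.ofReal_add hr hr, ← ENNReal.ofReal_mul hB0,
      ← ENNReal.ofReal_mul (by positivity)]
    congr 1
    have : r ^ (2 * k) = r ^ (2 * k - 1) * r := by
      rw [← pow_succ]; congr 1; omega
    rw [hB, this]; ring
  have hconst : 2 * ((2 * k + 1 : ℕ) : ℝ≥0∞) ^ 2 * (ENNReal.ofReal r) ^ (2 * k)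
      = ENNReal.ofReal (2 * ((2 * k + 1 : ℕ) : ℝ) ^ 2 * r ^ (2 * k)) := by
    rw [ENNReal.ofReal_mul (by positivity), ENNReal.ofReal_mul (by positivity),
      ENNReal.ofReal_pow hr, ENNReal.ofReal_pow (by positivity), ENNReal.ofReal_natCast]
    norm_num
  have hk0 : (0 : ℝ) ≤ k := k.cast_nonneg
  calc eLpNorm (gagliardoYQuotient G) 2 volume
      ≤ eLpNorm (fun q => ENNReal.ofReal A * gagliardoYQuotient (u - v) q + ENNReal.ofReal B *
        (gagliardoYQuotient u q + gagliardoYQuotient v q)) 2 volume :=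
        eLpNorm_mono_enorm_ae (by simpa using key)
    _ ≤ ENNReal.ofReal A * eLpNorm (gagliardoYQuotient (u - v)) 2 volume + ENNReal.ofReal B *
        (eLpNorm (gagliardoYQuotient u) 2 volume + eLpNorm (gagliardoYQuotient v) 2 volume) := by
        refine (eLpNorm_add_le (mw.const_mul _).aestronglyMeasurable
          ((mu.add mv).const_mul _).aestronglyMeasurable one_le_two).trans ?_
        rw [eLpNorm_two_const_mul _ mw, eLpNorm_two_const_mul _ (mu.add mv)]
        gcongr
        exact eLpNorm_add_le mu.aestronglyMeasurable mv.aestronglyMeasurable one_le_two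
    _ ≤ ENNReal.ofReal A * eLpNorm (gagliardoYQuotient (u - v)) 2 volume + ENNReal.ofReal B *
        (ENNReal.ofReal r + ENNReal.ofReal r) := by gcongr
    _ ≤ _ := by
        rw [hrB, hconst, mul_add]
        gcongr ENNReal.ofReal ?_ * _ + ENNReal.ofReal ?_ * _
        · gcongr
          push_cast
          nlinarith
        · gcongr ?_ * _
          push_cast
          nlinarith
end
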